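/- Let κ ≠ 0 be a real number, let Ω ⊆ {(t,x) ∈ ℝ² : t + x > 0} be open, and let v : ℝ² → ℝ be C² on Ω satisfying the transformed equation (EP') on Ω. Then the function w(t,x) = v_x(t,x) + (2κ−1)·v(t,x)/(κ(t+x)) satisfies the first-order equation w_t(t,x) = −2(κ−1)·w(t,x)/(κ(t+x)) at every point of Ω. -/

import Mathlib

open Real Set

/-- Partial derivative with respect to the first variable. -/
noncomputable def pdt (f : ℝ × ℝ → ℝ) (p : ℝ × ℝ) : ℝ :=
  deriv (fun s => f (s, p.2)) p.1

/-- Partial derivative with respect to the second variable. -/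
noncomputable def pdx (f : ℝ × ℝ → ℝ) (p : ℝ × ℝ) : ℝ :=
  deriv (fun s => f (p.1, s)) p.2

/-- The partial derivative in the second variable is the Fréchet derivative along `(0, 1)`. -/
theorem pdx_eq_fderiv {f : ℝ × ℝ → ℝ} {p : ℝ × ℝ} (hf : DifferentiableAt ℝ f p) :
    pdx f p = fderiv ℝ f p (0, 1) :=
  (hf.hasFDerivAt.comp_hasDerivAt p.2
    ((hasDerivAt_const p.2 p.1).prodMk (hasDerivAt_id p.2))).deriv

/-- The slice of a differentiable function in the first variable has derivative `pdt`. -/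
theorem hasDerivAt_pdt {f : ℝ × ℝ → ℝ} {p : ℝ × ℝ} (hf : DifferentiableAt ℝ f p) :
    HasDerivAt (fun s => f (s, p.2)) (pdt f p) p.1 :=
  (hf.hasFDerivAt.comp_hasDerivAt p.1
    ((hasDerivAt_id p.1).prodMk (hasDerivAt_const p.1 p.2))).differentiableAt.hasDerivAt

/-- The partial derivative in the second variable of a `C²` function is differentiable. -/
theorem ContDiffAt.differentiableAt_pdx {f : ℝ × ℝ → ℝ} {p : ℝ × ℝ}
    (hf : ContDiffAt ℝ 2 f p) : DifferentiableAt ℝ (pdx f) p := by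
  have hfderiv : DifferentiableAt ℝ (fderiv ℝ f) p :=
    (hf.fderiv_right (m := 1) (by norm_num)).differentiableAt (by norm_num)
  refine (hfderiv.clm_apply (differentiableAt_const ((0, 1) : ℝ × ℝ))).congr_of_eventuallyEq ?_
  filter_upwards [hf.eventually (by simp)] with q hq
  exact pdx_eq_fderiv (hq.differentiableAt (by norm_num))

/-- For a solution v of the transformed equation (EP'), the function
w = v_x + (2κ-1)v/(κ(t+x)) satisfies a first-order equation. -/
theorem substitution_gives_first_order_equation
    (κ : ℝ) (hκ : κ ≠ 0)
    (Ω : Set (ℝ × ℝ)) (hΩopen : IsOpen Ω)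
    (hΩpos : ∀ p ∈ Ω, 0 < p.1 + p.2)
    (v : ℝ × ℝ → ℝ) (hv : ContDiffOn ℝ 2 v Ω)
    (hEP' : ∀ p ∈ Ω, pdt (pdx v) p =
      (1 - 2 * κ) * pdt v p / (κ * (p.1 + p.2))
      + 2 * (1 - κ) * pdx v p / (κ * (p.1 + p.2))
      - (2 * κ - 1) * (κ - 2) * v p / (κ * (p.1 + p.2)) ^ 2)
    (w : ℝ × ℝ → ℝ)
    (hw : ∀ q : ℝ × ℝ, w q = pdx v q + (2 * κ - 1) * v q / (κ * (q.1 + q.2))) :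
    ∀ p ∈ Ω, pdt w p = -2 * (κ - 1) * w p / (κ * (p.1 + p.2)) := by
  intro p hp
  have hC : ContDiffAt ℝ 2 v p := hv.contDiffAt (hΩopen.mem_nhds hp)
  have hs : p.1 + p.2 ≠ 0 := (hΩpos p hp).ne'
  have hden : HasDerivAt (fun s => κ * (s + p.2)) κ p.1 := by
    simpa using ((hasDerivAt_id p.1).add_const p.2).const_mul κ
  have hderiv := (hasDerivAt_pdt hC.differentiableAt_pdx).add
    (((hasDerivAt_pdt (hC.differentiableAt (by norm_num))).const_mul (2 * κ - 1)).div hden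
      (mul_ne_zero hκ hs))
  have hwt : pdt w p = _ :=
    (hderiv.congr_of_eventuallyEq (.of_forall fun s => hw (s, p.2))).deriv
  rw [hwt, hw p, hEP' p hp]
  field_simp
  ring
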